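/- For every integer n ≥ 1 and every natural number L, the number of fully commutative involutions w in the Coxeter group of type A_{n-1} with Coxeter length ℓ(w) = L equals the number of walks in M*_n with total height L. -/

import Mathlib

open CoxeterSystem

/-- A single commutation move: transposition of two adjacent letters `a`, `b`
with `M a b = 2`. -/
def CommMove {B : Type*} (M : CoxeterMatrix B) (w w' : List B) : Prop :=
  ∃ (u v : List B) (a b : B), M a b = 2 ∧ w = u ++ a :: b :: v ∧ w' = u ++ b :: a :: v

/-- Commutation equivalence of words: two words are commutation-equivalent if one can be
obtained from the other by a sequence of transpositions of adjacent commuting letters. -/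
def CommEquiv {B : Type*} (M : CoxeterMatrix B) : List B → List B → Prop :=
  Relation.EqvGen (CommMove M)

/-- An element is fully commutative if all its reduced words are commutation-equivalent. -/
def IsFullyCommutative {B W : Type*} [Group W] {M : CoxeterMatrix B}
    (cs : CoxeterSystem M W) (w : W) : Prop :=
  ∀ u v : List B, cs.IsReduced u → cs.wordProd u = w →
    cs.IsReduced v → cs.wordProd v = w → CommEquiv M u v

/-- A fully commutative involution (the identity is allowed). -/
def IsFCInvolution {B W : Type*} [Group W] {M : CoxeterMatrix B}
    (cs : CoxeterSystem M W) (w : W) : Prop :=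
  IsFullyCommutative cs w ∧ w * w = 1

/-- The Coxeter matrix of type `A_n`: generators `s_1, …, s_n` (index `k : Fin n`
corresponds to `s_{k+1}`), with `m(s_i, s_j) = 3` if `|i - j| = 1`
and `m(s_i, s_j) = 2` if `|i - j| ≥ 2`. -/
def typeA (n : ℕ) : CoxeterMatrix (Fin n) where
  M := Matrix.of fun i j : Fin n =>
    if (i : ℕ) = (j : ℕ) then 1
    else if (i : ℕ) + 1 = (j : ℕ) ∨ (j : ℕ) + 1 = (i : ℕ) then 3
    else 2
  isSymm := by
    ext i j
    simp only [Matrix.transpose_apply, Matrix.of_apply]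
    split_ifs <;> omega
  diagonal := by intro i; simp [Matrix.of_apply]
  off_diagonal := by
    intro i j hij
    have h : (i : ℕ) ≠ (j : ℕ) := fun h => hij (Fin.ext h)
    simp only [Matrix.of_apply]
    split_ifs <;> omega

/-- A valid step of a Dyck-type walk between consecutive heights `a`, `b`:
an up step `(1,1)`, a down step `(1,-1)`, or a horizontal step `(1,0)`, the latter
being allowed only between points on the `x`-axis. -/
def IsWalkStep (a b : ℕ) : Prop := b = a + 1 ∨ a = b + 1 ∨ (a = 0 ∧ b = 0)

/-- A step which is an up step `(1,1)` or a down step `(1,-1)` (no horizontal step). -/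
def IsPMStep (a b : ℕ) : Prop := b = a + 1 ∨ a = b + 1

/-- A walk of length `n`, recorded by its sequence of heights `h 0, h 1, …, h n`
(the `i`-th point of the walk is `(i, h i)`). -/
def IsWalk (n : ℕ) (h : Fin (n + 1) → ℕ) : Prop :=
  ∀ i : Fin n, IsWalkStep (h i.castSucc) (h i.succ)

/-- A walk of length `n` with no horizontal step. -/
def IsPMWalk (n : ℕ) (h : Fin (n + 1) → ℕ) : Prop :=
  ∀ i : Fin n, IsPMStep (h i.castSucc) (h i.succ)

/-- Walks in `M*_n`: walks of length `n` from `(0,0)` to `(n,0)` (horizontal steps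
allowed at height `0`). -/
def IsMStarWalk (n : ℕ) (h : Fin (n + 1) → ℕ) : Prop :=
  IsWalk n h ∧ h 0 = 0 ∧ h (Fin.last n) = 0

/-- Walks in `M_n` (Dyck paths): walks of length `n` from `(0,0)` to `(n,0)` with no
horizontal step. -/
def IsMWalk (n : ℕ) (h : Fin (n + 1) → ℕ) : Prop :=
  IsPMWalk n h ∧ h 0 = 0 ∧ h (Fin.last n) = 0

/-- Walks in `Q_n` (prefixes of Dyck paths): walks of length `n` starting at `(0,0)`
with no horizontal step, ending at arbitrary height. -/
def IsQWalk (n : ℕ) (h : Fin (n + 1) → ℕ) : Prop :=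
  IsPMWalk n h ∧ h 0 = 0

/-- Walks in `Q^o_n`: prefixes of Dyck paths of length `n` ending at odd height. -/
def IsQoWalk (n : ℕ) (h : Fin (n + 1) → ℕ) : Prop :=
  IsQWalk n h ∧ Odd (h (Fin.last n))

/-- The total height of a walk: the sum of the heights of its points. -/
def totalHeight (n : ℕ) (h : Fin (n + 1) → ℕ) : ℕ := ∑ i, h i

namespace FCInvolution

open Equiv

/-! ### Crossing numbers -/

/-- The number of `k < x` whose image under `f` is at least `x`. -/
def crossings (f : Perm ℕ) (x : ℕ) : ℕ := ∑ k ∈ Finset.range x, if x ≤ f k then 1 else 0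

lemma crossings_one (x : ℕ) : crossings 1 x = 0 := by
  refine Finset.sum_eq_zero fun k hk => if_neg ?_
  simpa using hk

lemma crossings_zero (f : Perm ℕ) : crossings f 0 = 0 := by simp [crossings]

lemma swap_apply_of_ne_succ {j k : ℕ} (h : k ≠ j) (h' : k ≠ j + 1) : swap j (j + 1) k = k :=
  swap_apply_of_ne_of_ne h h'

lemma crossings_mul_swap_of_ne (f : Perm ℕ) {j x : ℕ} (hx : x ≠ j + 1) :
    crossings (f * swap j (j + 1)) x = crossings f x := by
  unfold crossings
  refine Finset.sum_equiv (swap j (j + 1)) (fun k => ?_) (fun k _ => rfl)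
  simp only [Finset.mem_range]
  rcases eq_or_ne k j with rfl | h
  · rw [swap_apply_left]; omega
  rcases eq_or_ne k (j + 1) with rfl | h'
  · rw [swap_apply_right]; omega
  rw [swap_apply_of_ne_succ h h']

lemma crossings_mul_swap_self (f : Perm ℕ) (j : ℕ) :
    crossings (f * swap j (j + 1)) (j + 1) + (if j + 1 ≤ f j then 1 else 0) =
      crossings f (j + 1) + (if j + 1 ≤ f (j + 1) then 1 else 0) := by
  unfold crossings
  rw [Finset.sum_range_succ, Finset.sum_range_succ]
  have : ∀ k ∈ Finset.range j, (if j + 1 ≤ (f * swap j (j + 1)) k then 1 else 0) =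
      (if j + 1 ≤ f k then 1 else 0) := by
    intro k hk
    rw [Finset.mem_range] at hk
    rw [Perm.mul_apply, swap_apply_of_ne_succ (by omega) (by omega)]
  rw [Finset.sum_congr rfl this]
  simp only [Perm.mul_apply, swap_apply_left]
  ring

lemma crossings_inv (f : Perm ℕ) (x : ℕ) : crossings f⁻¹ x = crossings f x := by
  simp only [crossings, ← Finset.card_filter]
  have h1 : {k ∈ Finset.range x | x ≤ f⁻¹ k} =
      Finset.range x \ (Finset.range x).map f.toEmbedding := by
    ext k
    simp only [Finset.mem_filter, Finset.mem_sdiff, Finset.mem_range, Finset.mem_map_equiv, not_lt]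
    rfl
  have h2 : {k ∈ Finset.range x | x ≤ f k}.map f.toEmbedding =
      (Finset.range x).map f.toEmbedding \ Finset.range x := by
    ext k
    simp [Finset.mem_map_equiv]
  rw [h1, ← Finset.card_map f.toEmbedding (s := {k ∈ Finset.range x | x ≤ f k}), h2]
  exact Finset.card_sdiff_comm (by simp)

/-- For an involution `f`, the crossing number goes up at `x` when `x < f x`, down when `f x < x`,
and is unchanged at a fixed point. -/
lemma crossings_succ {f : Perm ℕ} (hf : ∀ k, f (f k) = k) (x : ℕ) :
    crossings f (x + 1) + (if f x < x then 1 else 0) =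
      crossings f x + (if x < f x then 1 else 0) := by
  have key : ∑ k ∈ Finset.range x, (if x ≤ f k then 1 else 0) =
      ∑ k ∈ Finset.range x, (if x + 1 ≤ f k then 1 else 0) + (if f x < x then 1 else 0) := by
    have h1 : (if f x < x then 1 else 0) = ∑ k ∈ Finset.range x, if k = f x then 1 else 0 := by
      simp
    rw [h1, ← Finset.sum_add_distrib]
    refine Finset.sum_congr rfl fun k _ => ?_
    have : k = f x ↔ f k = x := ⟨fun h => h ▸ hf x, fun h => h ▸ (hf k).symm⟩
    simp only [this]
    split_ifs <;> omega
  unfold crossings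
  rw [Finset.sum_range_succ, key]
  simp only [Nat.succ_le_iff]
  omega

/-- Every inversion `(r, p)` of `f` consists of an excedance `r` and an anti-excedance `p`. -/
def InversionsStraddle (f : Perm ℕ) : Prop := ∀ r p, r < p → f p < f r → r < f r ∧ f p < p

lemma InversionsStraddle.mul_swap {f : Perm ℕ} (hf : InversionsStraddle f) {j : ℕ}
    (h : f j ≤ j) (h' : j + 1 ≤ f (j + 1)) : InversionsStraddle (f * swap j (j + 1)) := by
  intro r p hrp hinv
  have key : ∀ k, (f * swap j (j + 1)) k =
      if k = j then f (j + 1) else if k = j + 1 then f j else f k := by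
    intro k
    rw [Perm.mul_apply, swap_apply_def]
    split_ifs <;> rfl
  rw [key, key] at *
  have h1 := hf r p hrp
  have h2 := hf r j
  have h3 := hf r (j + 1)
  have h4 := hf j p
  have h5 := hf (j + 1) p
  grind

lemma InversionsStraddle.crossings_eq_zero {f : Perm ℕ} (hf : InversionsStraddle f) {x : ℕ}
    (hx : f x = x) : crossings f x = 0 := by
  refine Finset.sum_eq_zero fun k hk => ?_
  rw [Finset.mem_range] at hk
  have h := hf k x hk
  have hne : f k ≠ f x := fun e => hk.ne (f.injective e)
  simp only [ite_eq_right_iff, one_ne_zero, imp_false]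
  omega

/-- An involution whose inversions straddle the diagonal is determined by its crossing numbers. -/
lemma InversionsStraddle.eq_of_crossings_eq {f g : Perm ℕ} (hf : InversionsStraddle f)
    (hg : InversionsStraddle g) (hf2 : ∀ k, f (f k) = k) (hg2 : ∀ k, g (g k) = k)
    (h : ∀ x, crossings f x = crossings g x) : f = g := by
  have hup : ∀ x, x < f x ↔ x < g x := by
    intro x
    have h1 := crossings_succ hf2 x
    have h2 := crossings_succ hg2 x
    have h3 := h x
    have h4 := h (x + 1)
    split_ifs at h1 h2 <;> omega
  have hdown : ∀ x, f x < x ↔ g x < x := by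
    intro x
    have h1 := crossings_succ hf2 x
    have h2 := crossings_succ hg2 x
    have h3 := h x
    have h4 := h (x + 1)
    split_ifs at h1 h2 <;> omega
  -- the excedance values of `f` cannot lag behind those of `g`
  have aux : ∀ {f g : Perm ℕ}, InversionsStraddle g → (∀ k, f (f k) = k) → (∀ k, g (g k) = k) →
      (∀ x, f x < x ↔ g x < x) → ∀ r, (∀ s < r, f s = g s) → r < f r → g r ≤ f r := by
    intro f g hg hf2 hg2 hdown r ih hr
    by_contra! hlt
    have h1 : g (f r) < f r := (hdown _).1 (by rwa [hf2])
    have h2 := hg2 (f r)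
    rcases lt_trichotomy (g (f r)) r with hs | hs | hs
    · have h3 := ih _ hs
      rw [h2] at h3
      exact hs.ne (f.injective h3)
    · rw [hs] at h2
      omega
    · have := hg r _ hs (by omega)
      omega
  ext r
  induction r using Nat.strong_induction_on with
  | _ r ih =>
    rcases lt_trichotomy (f r) r with hr | hr | hr
    · have h1 := ih _ hr
      rw [hf2] at h1
      have h2 := hg2 (f r)
      rw [← h1] at h2
      exact h2.symm
    · have := hup r
      have := hdown r
      omega
    · exact le_antisymm
        (aux hf hg2 hf2 (fun x => (hdown x).symm) r (fun s hs => (ih s hs).symm) ((hup r).1 hr))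
        (aux hg hf2 hg2 hdown r ih hr)

/-! ### Commutation equivalence -/

section CommEquiv

variable {B W : Type*} [Group W] {M : CoxeterMatrix B}

lemma _root_.CommEquiv.refl (u : List B) : CommEquiv M u u := Relation.EqvGen.refl u

lemma _root_.CommEquiv.symm {u v : List B} (h : CommEquiv M u v) : CommEquiv M v u :=
  Relation.EqvGen.symm u v h

lemma _root_.CommEquiv.trans {u v w : List B} (h : CommEquiv M u v) (h' : CommEquiv M v w) :
    CommEquiv M u w := Relation.EqvGen.trans u v w h h'

lemma _root_.CommEquiv.cons {u v : List B} (a : B) (h : CommEquiv M u v) :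
    CommEquiv M (a :: u) (a :: v) := by
  induction h with
  | rel u v h =>
    obtain ⟨x, y, b, c, hbc, rfl, rfl⟩ := h
    exact .rel _ _ ⟨a :: x, y, b, c, hbc, rfl, rfl⟩
  | refl u => exact .refl _
  | symm u v _ ih => exact .symm ih
  | trans u v w _ _ ih ih' => exact .trans ih ih'

lemma _root_.CommEquiv.swap {a b : B} (h : M a b = 2) (u : List B) :
    CommEquiv M (a :: b :: u) (b :: a :: u) :=
  .rel _ _ ⟨[], u, a, b, h, rfl, rfl⟩

lemma _root_.CommEquiv.perm {u v : List B} (h : CommEquiv M u v) : u.Perm v := by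
  induction h with
  | rel u v h =>
    obtain ⟨x, y, b, c, -, rfl, rfl⟩ := h
    exact (List.Perm.swap c b y).append_left x
  | refl u => exact .refl _
  | symm u v _ ih => exact ih.symm
  | trans u v w _ _ ih ih' => exact ih.trans ih'

lemma simple_mul_simple_comm (cs : CoxeterSystem M W) {a b : B} (h : M a b = 2) :
    cs.simple a * cs.simple b = cs.simple b * cs.simple a := by
  have := cs.simple_mul_simple_pow a b
  rw [h, sq, mul_eq_one_iff_eq_inv] at this
  simpa using this

lemma _root_.CommEquiv.wordProd_eq (cs : CoxeterSystem M W) {u v : List B} (h : CommEquiv M u v) :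
    cs.wordProd u = cs.wordProd v := by
  induction h with
  | rel u v h =>
    obtain ⟨x, y, b, c, hbc, rfl, rfl⟩ := h
    simp only [cs.wordProd_append, cs.wordProd_cons]
    rw [← mul_assoc (cs.simple b), simple_mul_simple_comm cs hbc, mul_assoc]
  | refl u => rfl
  | symm u v _ ih => exact ih.symm
  | trans u v w _ _ ih ih' => exact ih.trans ih'

lemma simple_braid (cs : CoxeterSystem M W) {a b : B} (h : M a b = 3) :
    cs.simple a * cs.simple b * cs.simple a = cs.simple b * cs.simple a * cs.simple b := by
  have h3 := cs.simple_mul_simple_pow a b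
  rw [h, pow_succ, sq, mul_eq_one_iff_eq_inv, mul_inv_rev, cs.inv_simple, cs.inv_simple] at h3
  calc cs.simple a * cs.simple b * cs.simple a
      = cs.simple a * cs.simple b * (cs.simple a * cs.simple b) * cs.simple b := by
        simp [mul_assoc]
    _ = cs.simple b * cs.simple a * cs.simple b := by rw [h3]

/-- No word commutation-equivalent to `u` contains a square or a braid of length three. -/
def BraidAvoiding (M : CoxeterMatrix B) (u : List B) : Prop :=
  ∀ v, CommEquiv M u v → ∀ x y a b, v ≠ x ++ a :: a :: y ∧ (M a b = 3 → v ≠ x ++ a :: b :: a :: y)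

lemma BraidAvoiding.of_cons {a : B} {u : List B} (h : BraidAvoiding M (a :: u)) :
    BraidAvoiding M u := by
  intro v hv x y b c
  obtain ⟨h1, h2⟩ := h _ (hv.cons a) (a :: x) y b c
  exact ⟨fun e => h1 (by simp [e]), fun hbc e => h2 hbc (by simp [e])⟩

lemma braidAvoiding_of_isFullyCommutative (cs : CoxeterSystem M W) {u : List B}
    (hu : cs.IsReduced u) (hfc : IsFullyCommutative cs (cs.wordProd u)) : BraidAvoiding M u := by
  classical
  intro v hv x y a b
  have hv' : cs.IsReduced v := by
    unfold CoxeterSystem.IsReduced at *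
    rw [← hv.wordProd_eq cs, hu, hv.perm.length_eq]
  refine ⟨?_, ?_⟩
  · rintro rfl
    have h1 := cs.length_wordProd_le (x ++ y)
    have h2 : cs.wordProd (x ++ a :: a :: y) = cs.wordProd (x ++ y) := by
      simp [cs.wordProd_append, cs.wordProd_cons]
    unfold CoxeterSystem.IsReduced at hv'
    rw [h2] at hv'
    simp only [List.length_append, List.length_cons] at h1 hv'
    omega
  · rintro hab rfl
    have h2 : cs.wordProd (x ++ a :: b :: a :: y) = cs.wordProd (x ++ b :: a :: b :: y) := by
      simp only [cs.wordProd_append, cs.wordProd_cons, ← mul_assoc]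
      rw [mul_assoc (cs.wordProd x), mul_assoc (cs.wordProd x), simple_braid cs hab]
      simp only [mul_assoc]
    have h3 : cs.IsReduced (x ++ b :: a :: b :: y) := by
      unfold CoxeterSystem.IsReduced at *
      rw [← h2, hv']
      simp
    have h4 := (hfc _ _ hv' (hv.wordProd_eq cs).symm h3
      (h2.symm.trans (hv.wordProd_eq cs).symm)).perm.count_eq a
    have hne : b ≠ a := by
      rintro rfl
      simp at hab
    simp [hne] at h4

end CommEquiv

/-! ### Words in type `A` and permutations of `ℕ` -/

section TypeA

variable {m : ℕ}

lemma typeA_apply (i j : Fin m) : typeA m i j =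
    if (i : ℕ) = j then 1 else if (i : ℕ) + 1 = j ∨ (j : ℕ) + 1 = i then 3 else 2 := rfl

lemma isLiftable_swap :
    (typeA m).IsLiftable (fun j : Fin m => Equiv.swap (j : ℕ) (j + 1)) := by
  intro i j
  rw [typeA_apply]
  split_ifs with h h'
  · simp [h]
  · ext k
    simp only [pow_succ, pow_zero, one_mul, Perm.mul_apply, swap_apply_def, Perm.one_apply]
    grind
  · ext k
    simp only [pow_succ, pow_zero, one_mul, Perm.mul_apply, swap_apply_def, Perm.one_apply]
    grind

/-- The inverse of the permutation of `ℕ` represented by a word. -/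
def wordPerm : List (Fin m) → Perm ℕ
  | [] => 1
  | j :: u => wordPerm u * Equiv.swap (j : ℕ) (j + 1)

/-- The permutation representation of the Coxeter group of type `A`. -/
noncomputable def toPerm (m : ℕ) : (typeA m).Group →* Perm ℕ :=
  (typeA m).toCoxeterSystem.lift ⟨_, isLiftable_swap⟩

lemma toPerm_wordProd (u : List (Fin m)) :
    (toPerm m ((typeA m).toCoxeterSystem.wordProd u))⁻¹ = wordPerm u := by
  induction u with
  | nil => simp [wordPerm]
  | cons j u ih =>
    rw [CoxeterSystem.wordProd_cons, map_mul, mul_inv_rev, ih, wordPerm, toPerm,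
      CoxeterSystem.lift_apply_simple, swap_inv]

lemma wordPerm_append (u v : List (Fin m)) : wordPerm (u ++ v) = wordPerm v * wordPerm u := by
  induction u with
  | nil => simp [wordPerm]
  | cons j u ih => rw [List.cons_append, wordPerm, ih, wordPerm, mul_assoc]

lemma wordPerm_reverse (u : List (Fin m)) : wordPerm u.reverse = (wordPerm u)⁻¹ := by
  rw [← toPerm_wordProd, ← toPerm_wordProd, CoxeterSystem.wordProd_reverse, map_inv]

lemma _root_.CommEquiv.wordPerm_eq {u v : List (Fin m)} (h : CommEquiv (typeA m) u v) :
    wordPerm u = wordPerm v := by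
  rw [← toPerm_wordProd, ← toPerm_wordProd, CommEquiv.wordProd_eq _ h]

lemma wordPerm_cons_apply (j : Fin m) (u : List (Fin m)) (k : ℕ) :
    wordPerm (j :: u) k =
      if k = j then wordPerm u (j + 1) else if k = j + 1 then wordPerm u j else wordPerm u k := by
  rw [wordPerm, Perm.mul_apply, swap_apply_def]
  split_ifs <;> rfl

/-- Every letter of the word, read from the right, creates a new crossing. -/
def Tight : List (Fin m) → Prop
  | [] => True
  | j :: u => Tight u ∧ wordPerm u j ≤ j ∧ (j : ℕ) + 1 ≤ wordPerm u (j + 1)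

lemma crossings_wordPerm_cons_of_ne {j : Fin m} {x : ℕ} (u : List (Fin m)) (hx : x ≠ j + 1) :
    crossings (wordPerm (j :: u)) x = crossings (wordPerm u) x :=
  crossings_mul_swap_of_ne _ hx

lemma crossings_wordPerm_cons_self (j : Fin m) (u : List (Fin m)) :
    crossings (wordPerm (j :: u)) (j + 1) + (if (j : ℕ) + 1 ≤ wordPerm u j then 1 else 0) =
      crossings (wordPerm u) (j + 1) + (if (j : ℕ) + 1 ≤ wordPerm u (j + 1) then 1 else 0) :=
  crossings_mul_swap_self _ _

lemma crossings_wordPerm_le_count (u : List (Fin m)) (i : Fin m) :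
    crossings (wordPerm u) (i + 1) ≤ u.count i := by
  induction u with
  | nil => simp [wordPerm, crossings_one]
  | cons j u ih =>
    rcases eq_or_ne i j with rfl | h
    · have := crossings_wordPerm_cons_self i u
      rw [List.count_cons_self]
      split_ifs at this <;> omega
    · rw [crossings_wordPerm_cons_of_ne u (by simpa [Fin.ext_iff] using h),
        List.count_cons_of_ne h.symm]
      exact ih

lemma crossings_wordPerm_eq_zero (u : List (Fin m)) {x : ℕ} (hx : m < x) :
    crossings (wordPerm u) x = 0 := by
  induction u with
  | nil => simp [wordPerm, crossings_one]
  | cons j u ih => rw [crossings_wordPerm_cons_of_ne u (by omega), ih]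

lemma tight_iff_count_eq (u : List (Fin m)) :
    Tight u ↔ ∀ i : Fin m, u.count i = crossings (wordPerm u) (i + 1) := by
  induction u with
  | nil => simp [Tight, wordPerm, crossings_one]
  | cons j u ih =>
    have hself := crossings_wordPerm_cons_self j u
    have hle := crossings_wordPerm_le_count u j
    rw [Tight, ih]
    constructor
    · rintro ⟨h, h1, h2⟩ i
      rcases eq_or_ne i j with rfl | hij
      · rw [List.count_cons_self, h]
        split_ifs at hself <;> omega
      · rw [crossings_wordPerm_cons_of_ne u (by simpa [Fin.ext_iff] using hij),
          List.count_cons_of_ne hij.symm, h]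
    · intro h
      have hj := h j
      rw [List.count_cons_self] at hj
      refine ⟨fun i => ?_, ?_⟩
      · rcases eq_or_ne i j with rfl | hij
        · split_ifs at hself <;> omega
        · rw [← crossings_wordPerm_cons_of_ne u (by simpa [Fin.ext_iff] using hij),
            ← h, List.count_cons_of_ne hij.symm]
      · split_ifs at hself <;> omega

lemma Tight.inversionsStraddle {u : List (Fin m)} (h : Tight u) :
    InversionsStraddle (wordPerm u) := by
  induction u with
  | nil =>
    intro r p h1 h2
    simp only [wordPerm, Perm.one_apply] at h2
    omega
  | cons j u ih => exact (ih h.1).mul_swap h.2.1 h.2.2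

lemma Tight.of_commEquiv {u v : List (Fin m)} (h : Tight u) (huv : CommEquiv (typeA m) u v) :
    Tight v := by
  rw [tight_iff_count_eq] at *
  intro i
  rw [← huv.perm.count_eq, h, huv.wordPerm_eq]

lemma Tight.reverse {u : List (Fin m)} (h : Tight u) : Tight u.reverse := by
  rw [tight_iff_count_eq] at *
  intro i
  rw [List.count_reverse, wordPerm_reverse, crossings_inv, h]

lemma sum_count_eq_length (u : List (Fin m)) : ∑ i, u.count i = u.length := by
  simpa using Multiset.sum_count_eq_card (s := Finset.univ) (m := (u : Multiset (Fin m))) (by simp)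

lemma sum_crossings_le_length (u : List (Fin m)) :
    ∑ i : Fin m, crossings (wordPerm u) (i + 1) ≤ u.length := by
  rw [← sum_count_eq_length]
  exact Finset.sum_le_sum fun i _ => crossings_wordPerm_le_count u i

lemma tight_iff_length_eq (u : List (Fin m)) :
    Tight u ↔ u.length = ∑ i : Fin m, crossings (wordPerm u) (i + 1) := by
  rw [tight_iff_count_eq, ← sum_count_eq_length, eq_comm,
    Finset.sum_eq_sum_iff_of_le fun i _ => crossings_wordPerm_le_count u i]
  simp [eq_comm]

lemma Tight.isReduced {u : List (Fin m)} (h : Tight u) :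
    (typeA m).toCoxeterSystem.IsReduced u := by
  obtain ⟨v, hv, huv⟩ := (typeA m).toCoxeterSystem.exists_isReduced
    ((typeA m).toCoxeterSystem.wordProd u)
  refine le_antisymm (CoxeterSystem.length_wordProd_le _ _) ?_
  rw [huv, hv.eq, (tight_iff_length_eq u).1 h, ← toPerm_wordProd, huv, toPerm_wordProd]
  exact sum_crossings_le_length v

lemma Tight.of_isReduced {u v : List (Fin m)} (h : Tight u)
    (hv : (typeA m).toCoxeterSystem.IsReduced v)
    (huv : (typeA m).toCoxeterSystem.wordProd v = (typeA m).toCoxeterSystem.wordProd u) :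
    Tight v := by
  rw [tight_iff_length_eq, ← hv.eq, huv, h.isReduced.eq, (tight_iff_length_eq u).1 h,
    ← toPerm_wordProd, ← huv, toPerm_wordProd]

lemma typeA_eq_two {i j : Fin m} (h : (i : ℕ) ≠ j) (h1 : (i : ℕ) + 1 ≠ j)
    (h2 : (j : ℕ) + 1 ≠ i) : typeA m i j = 2 := by
  simp [typeA_apply, h, h1, h2]

/-- A letter which does not create a crossing over a tight word can be moved to its front. -/
lemma Tight.exists_commEquiv_cons {u : List (Fin m)} (hu : Tight u) {j : Fin m}
    (h : (j : ℕ) ≤ wordPerm u j) (h' : wordPerm u (j + 1) ≤ j + 1)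
    (hne : ¬ (wordPerm u j = j ∧ wordPerm u (j + 1) = j + 1)) :
    ∃ v, CommEquiv (typeA m) u (j :: v) := by
  induction u with
  | nil => simp [wordPerm] at hne
  | cons k u ih =>
    obtain ⟨hu, h1, h2⟩ := hu
    simp only [wordPerm_cons_apply] at h h' hne
    rcases eq_or_ne k j with rfl | hkj
    · exact ⟨u, .refl _⟩
    have hkj' : (k : ℕ) ≠ j := by simpa [Fin.ext_iff] using hkj
    by_cases hk1 : (k : ℕ) = j + 1
    · grind
    by_cases hk2 : (k : ℕ) + 1 = j
    · grind
    have e1 : ¬ (j : ℕ) = k := by omega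
    have e2 : ¬ (j : ℕ) = k + 1 := by omega
    have e3 : ¬ (j : ℕ) + 1 = k := by omega
    have e4 : ¬ (j : ℕ) + 1 = k + 1 := by omega
    simp only [e1, e2, e3, e4, if_false] at h h' hne
    obtain ⟨v, hv⟩ := ih hu h h' hne
    exact ⟨k :: v, (hv.cons k).trans (.swap (typeA_eq_two hkj' hk2 (Ne.symm hk1)) v)⟩

lemma Tight.commEquiv {u v : List (Fin m)} (hu : Tight u) (hv : Tight v)
    (h : wordPerm u = wordPerm v) : CommEquiv (typeA m) u v := by
  induction u generalizing v with
  | nil =>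
    have hl := (tight_iff_length_eq v).1 hv
    rw [← h] at hl
    simp only [wordPerm, crossings_one, Finset.sum_const_zero, List.length_eq_zero_iff] at hl
    rw [hl]
    exact .refl _
  | cons j u ih =>
    have h1 := wordPerm_cons_apply j u j
    have h2 := wordPerm_cons_apply j u (j + 1)
    rw [h] at h1 h2
    simp only [if_true, Nat.add_eq_left, one_ne_zero, if_false] at h1 h2
    obtain ⟨hu, h3, h4⟩ := hu
    obtain ⟨w, hw⟩ := hv.exists_commEquiv_cons (j := j) (by omega) (by omega) (by omega)
    have hw' := hv.of_commEquiv hw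
    rw [hw.wordPerm_eq, wordPerm, wordPerm, mul_left_inj] at h
    exact ((ih hu hw'.1 h).cons j).trans hw.symm

lemma Tight.wordProd_eq {u v : List (Fin m)} (hu : Tight u) (hv : Tight v)
    (h : wordPerm u = wordPerm v) :
    (typeA m).toCoxeterSystem.wordProd u = (typeA m).toCoxeterSystem.wordProd v :=
  (hu.commEquiv hv h).wordProd_eq _

lemma Tight.isFullyCommutative {u : List (Fin m)} (hu : Tight u) :
    IsFullyCommutative (typeA m).toCoxeterSystem ((typeA m).toCoxeterSystem.wordProd u) := by
  intro v w hv hvu hw hwu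
  refine (hu.of_isReduced hv hvu).commEquiv (hu.of_isReduced hw hwu) ?_
  rw [← toPerm_wordProd, hvu, ← hwu, toPerm_wordProd]

/-- If both neighbouring positions are small or both are large, prepending the letter to a tight
word creates a braid. -/
lemma Tight.exists_braid {u : List (Fin m)} (hu : Tight u) {j : Fin m}
    (h : wordPerm u j ≤ j ∧ wordPerm u (j + 1) ≤ j ∨
      (j : ℕ) + 1 ≤ wordPerm u j ∧ (j : ℕ) + 1 ≤ wordPerm u (j + 1)) :
    ∃ x i y, typeA m j i = 3 ∧ CommEquiv (typeA m) (j :: u) (x ++ j :: i :: j :: y) := by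
  induction u with
  | nil => simp [wordPerm] at h
  | cons k u ih =>
    obtain ⟨hu, h1, h2⟩ := hu
    rw [wordPerm_cons_apply, wordPerm_cons_apply] at h
    rcases eq_or_ne k j with rfl | hkj
    · grind
    have hkj' : (k : ℕ) ≠ j := by simpa [Fin.ext_iff] using hkj
    by_cases hk : (k : ℕ) = j + 1 ∨ (k : ℕ) + 1 = j
    · obtain ⟨v, hv⟩ : ∃ v, CommEquiv (typeA m) u (j :: v) := by
        rcases hk with hk | hk
        · refine hu.exists_commEquiv_cons ?_ ?_ ?_ <;> grind
        · refine hu.exists_commEquiv_cons ?_ ?_ ?_ <;> grind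
      refine ⟨[], k, v, ?_, (hv.cons k).cons j⟩
      rw [typeA_apply, if_neg hkj'.symm, if_pos (by omega)]
    have e1 : ¬ (j : ℕ) = k := by omega
    have e2 : ¬ (j : ℕ) = k + 1 := by omega
    have e3 : ¬ (j : ℕ) + 1 = k := by omega
    have e4 : ¬ (j : ℕ) + 1 = k + 1 := by omega
    simp only [e1, e2, e3, e4, if_false] at h
    obtain ⟨x, i, y, hi, hv⟩ := ih hu h
    exact ⟨k :: x, i, y, hi,
      (CommEquiv.swap (typeA_eq_two e1 e3 (by omega)) u).trans (hv.cons k)⟩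

lemma BraidAvoiding.tight {u : List (Fin m)} (h : BraidAvoiding (typeA m) u) : Tight u := by
  induction u with
  | nil => trivial
  | cons j u ih =>
    have hu := ih h.of_cons
    by_contra hnot
    simp only [Tight, hu, true_and] at hnot
    by_cases h1 : (j : ℕ) + 1 ≤ wordPerm u j ∧ wordPerm u (j + 1) ≤ j
    · obtain ⟨v, hv⟩ := hu.exists_commEquiv_cons (j := j) (by omega) (by omega) (by omega)
      exact (h _ (hv.cons j) [] v j j).1 rfl
    · obtain ⟨x, i, y, hi, hv⟩ := hu.exists_braid (j := j) (by omega)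
      exact (h _ hv x y j i).2 hi rfl

end TypeA

/-! ### Walks -/

section Walks

variable {m : ℕ}

lemma isFullyCommutative_iff_exists_tight (w : (typeA m).Group) :
    IsFullyCommutative (typeA m).toCoxeterSystem w ↔
      ∃ u, Tight u ∧ (typeA m).toCoxeterSystem.wordProd u = w := by
  constructor
  · intro h
    obtain ⟨u, hu, rfl⟩ := (typeA m).toCoxeterSystem.exists_isReduced w
    exact ⟨u, (braidAvoiding_of_isFullyCommutative _ hu h).tight, rfl⟩
  · rintro ⟨u, hu, rfl⟩
    exact hu.isFullyCommutative

lemma isWalkStep_crossings {f : Perm ℕ} (hf : InversionsStraddle f) (hf2 : ∀ k, f (f k) = k)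
    (x : ℕ) : IsWalkStep (crossings f x) (crossings f (x + 1)) := by
  have h := crossings_succ hf2 x
  have h0 : f x = x → crossings f x = 0 := hf.crossings_eq_zero
  unfold IsWalkStep
  split_ifs at h <;> omega

/-- Prepending a letter at a place where a tight involution fixes both neighbouring positions. -/
lemma Tight.cons_of_fixed {u : List (Fin m)} (hu : Tight u)
    (hu2 : ∀ k, wordPerm u (wordPerm u k) = k) {j : Fin m} (h : wordPerm u j = j)
    (h' : wordPerm u (j + 1) = j + 1) :
    Tight (j :: u) ∧ (∀ k, wordPerm (j :: u) (wordPerm (j :: u) k) = k) ∧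
      crossings (wordPerm (j :: u)) (j + 1) = crossings (wordPerm u) (j + 1) + 1 := by
  refine ⟨⟨hu, by omega, by omega⟩, fun k => ?_, ?_⟩
  · simp only [wordPerm_cons_apply]
    have := hu2 k
    grind
  · have := crossings_wordPerm_cons_self j u
    split_ifs at this <;> omega

/-- Conjugating a tight involution at a valley. -/
lemma Tight.conj_of_valley {u : List (Fin m)} (hu : Tight u)
    (hu2 : ∀ k, wordPerm u (wordPerm u k) = k) {j : Fin m} (h : wordPerm u j < j)
    (h' : (j : ℕ) + 1 < wordPerm u (j + 1)) :
    Tight (j :: (u ++ [j])) ∧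
      (∀ k, wordPerm (j :: (u ++ [j])) (wordPerm (j :: (u ++ [j])) k) = k) ∧
      (∀ x : ℕ, x ≠ j + 1 → crossings (wordPerm (j :: (u ++ [j]))) x = crossings (wordPerm u) x) ∧
      crossings (wordPerm (j :: (u ++ [j]))) (j + 1) = crossings (wordPerm u) (j + 1) + 2 := by
  have hinv : (wordPerm u)⁻¹ = wordPerm u :=
    inv_eq_of_mul_eq_one_left (Equiv.ext fun k => hu2 k)
  have happ : wordPerm (u ++ [j]) = Equiv.swap (j : ℕ) (j + 1) * wordPerm u := by
    rw [wordPerm_append, wordPerm, wordPerm, one_mul]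
  have hcr : ∀ x, crossings (wordPerm (u ++ [j])) x = crossings (wordPerm (j :: u)) x := by
    intro x
    rw [happ, ← crossings_inv, mul_inv_rev, swap_inv, hinv, wordPerm]
  have hj : wordPerm (u ++ [j]) j = wordPerm u j := by
    rw [happ, Perm.mul_apply, swap_apply_of_ne_succ (by omega) (by omega)]
  have hj' : wordPerm (u ++ [j]) (j + 1) = wordPerm u (j + 1) := by
    rw [happ, Perm.mul_apply, swap_apply_of_ne_succ (by omega) (by omega)]
  have hu' : Tight (u ++ [j]) := by
    have htight : Tight (j :: u) := ⟨hu, by omega, by omega⟩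
    rw [tight_iff_count_eq] at htight ⊢
    intro i
    rw [hcr, ← htight]
    exact (List.perm_append_singleton j u).count_eq i
  refine ⟨⟨hu', by omega, by omega⟩, fun k => ?_, fun x hx => ?_, ?_⟩
  · rw [wordPerm, happ]
    simp [Perm.mul_apply, hu2]
  · rw [crossings_wordPerm_cons_of_ne _ hx, hcr, crossings_wordPerm_cons_of_ne _ hx]
  · have h1 := crossings_wordPerm_cons_self j u
    have h2 := crossings_wordPerm_cons_self j (u ++ [j])
    rw [hj, hj', hcr] at h2
    split_ifs at h1 h2 <;> omega

/-- Every walk is realized by the crossing numbers of a tight involution. -/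
lemma exists_tight_of_walk (h : ℕ → ℕ) (h0 : h 0 = 0) (hend : ∀ x, m < x → h x = 0)
    (hstep : ∀ x, IsWalkStep (h x) (h (x + 1))) :
    ∃ u : List (Fin m), Tight u ∧ (∀ k, wordPerm u (wordPerm u k) = k) ∧
      ∀ x, crossings (wordPerm u) x = h x := by
  induction hN : ∑ x ∈ Finset.range (m + 1), h x using Nat.strong_induction_on generalizing h with
  | _ N ih =>
  subst hN
  obtain ⟨y, hy, hmax⟩ := Finset.exists_max_image (Finset.range (m + 1)) h ⟨0, by simp⟩
  have hmax' : ∀ x, h x ≤ h y := by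
    intro x
    by_cases hx : x < m + 1
    · exact hmax x (by simpa using hx)
    · rw [hend x (by omega)]
      exact Nat.zero_le _
  rcases Nat.eq_zero_or_pos (h y) with hy0 | hypos
  · exact ⟨[], trivial, fun k => rfl, fun x => by
      rw [wordPerm, crossings_one]
      have := hmax' x
      omega⟩
  rw [Finset.mem_range] at hy
  obtain ⟨j, rfl⟩ : ∃ j, y = j + 1 := ⟨y - 1, by
    have : y ≠ 0 := by
      rintro rfl
      omega
    omega⟩
  have hs1 := hstep j
  have hs2 := hstep (j + 1)
  have hm1 := hmax' j
  have hm2 := hmax' (j + 1 + 1)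
  unfold IsWalkStep at hs1 hs2
  -- lower the peak at `j + 1` to `c`
  have lower : ∀ c, c < h (j + 1) → IsWalkStep (h j) c → IsWalkStep c (h (j + 1 + 1)) →
      ∃ u : List (Fin m), Tight u ∧ (∀ k, wordPerm u (wordPerm u k) = k) ∧
        ∀ x, crossings (wordPerm u) x = Function.update h (j + 1) c x := by
    intro c hc hc1 hc2
    refine ih _ ?_ _ (by simp [h0]) (fun x hx => ?_) (fun x => ?_) rfl
    · refine Finset.sum_lt_sum (fun x _ => ?_) ⟨j + 1, by simpa using hy, by simpa using hc⟩
      rw [Function.update_apply]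
      split_ifs with e
      · rw [e]
        exact hc.le
      · exact le_rfl
    · rw [Function.update_of_ne (by omega), hend x hx]
    · rcases eq_or_ne x j with rfl | hxj
      · simpa using hc1
      rcases eq_or_ne x (j + 1) with rfl | hxj'
      · simpa using hc2
      rw [Function.update_of_ne hxj', Function.update_of_ne (by omega)]
      exact hstep x
  have hval : ∀ {u : List (Fin m)} {c}, (∀ k, wordPerm u (wordPerm u k) = k) →
      (∀ x, crossings (wordPerm u) x = Function.update h (j + 1) c x) →
      c + (if wordPerm u j < j then 1 else 0) = h j + (if j < wordPerm u j then 1 else 0) ∧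
      h (j + 1 + 1) + (if wordPerm u (j + 1) < j + 1 then 1 else 0) =
        c + (if j + 1 < wordPerm u (j + 1) then 1 else 0) := by
    intro u c hu2 hu
    have h1 := crossings_succ hu2 j
    have h2 := crossings_succ hu2 (j + 1)
    simp only [hu] at h1 h2
    simpa using And.intro h1 h2
  by_cases h1 : h (j + 1) = 1
  · obtain ⟨u, hu, hu2, hcr⟩ := lower 0 (by omega) (by unfold IsWalkStep; omega)
      (by unfold IsWalkStep; omega)
    obtain ⟨e1, e2⟩ := hval hu2 hcr
    obtain ⟨a1, a2, a3⟩ := hu.cons_of_fixed hu2 (j := ⟨j, by omega⟩)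
      (by dsimp only; split_ifs at e1 <;> omega) (by dsimp only; split_ifs at e2 <;> omega)
    refine ⟨_, a1, a2, fun x => ?_⟩
    rcases eq_or_ne x (j + 1) with rfl | hx
    · rw [a3, hcr]
      simp [h1]
    · rw [crossings_wordPerm_cons_of_ne _ hx, hcr, Function.update_of_ne hx]
  · obtain ⟨u, hu, hu2, hcr⟩ := lower (h (j + 1) - 2) (by omega) (by unfold IsWalkStep; omega)
      (by unfold IsWalkStep; omega)
    obtain ⟨e1, e2⟩ := hval hu2 hcr
    obtain ⟨a1, a2, a3, a4⟩ := hu.conj_of_valley hu2 (j := ⟨j, by omega⟩)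
      (by dsimp only; split_ifs at e1 <;> omega) (by dsimp only; split_ifs at e2 <;> omega)
    refine ⟨_, a1, a2, fun x => ?_⟩
    rcases eq_or_ne x (j + 1) with rfl | hx
    · rw [a4, hcr, Function.update_self]
      omega
    · rw [a3 x hx, hcr, Function.update_of_ne hx]

/-- The heights of the walk attached to an element of the Coxeter group of type `A`. -/
noncomputable def heights (w : (typeA m).Group) (x : Fin (m + 1 + 1)) : ℕ :=
  crossings (toPerm m w)⁻¹ x

lemma heights_wordProd (u : List (Fin m)) :
    heights ((typeA m).toCoxeterSystem.wordProd u) =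
      fun x : Fin (m + 1 + 1) => crossings (wordPerm u) x := by
  ext x
  rw [heights, toPerm_wordProd]

lemma wordPerm_involutive {u : List (Fin m)} (h : (typeA m).toCoxeterSystem.wordProd u *
    (typeA m).toCoxeterSystem.wordProd u = 1) (k : ℕ) : wordPerm u (wordPerm u k) = k := by
  rw [← Perm.mul_apply, ← toPerm_wordProd, ← mul_inv_rev, ← map_mul, h, map_one, inv_one,
    Perm.one_apply]

lemma Tight.isFCInvolution {u : List (Fin m)} (hu : Tight u)
    (hu2 : ∀ k, wordPerm u (wordPerm u k) = k) :
    IsFCInvolution (typeA m).toCoxeterSystem ((typeA m).toCoxeterSystem.wordProd u) := by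
  refine ⟨hu.isFullyCommutative, ?_⟩
  have h : wordPerm u.reverse = wordPerm u := by
    rw [wordPerm_reverse]
    exact inv_eq_of_mul_eq_one_left (Equiv.ext fun k => hu2 k)
  have := hu.reverse.wordProd_eq hu h
  rw [CoxeterSystem.wordProd_reverse, inv_eq_iff_mul_eq_one] at this
  exact this

lemma isMStarWalk_heights {w : (typeA m).Group}
    (hw : IsFCInvolution (typeA m).toCoxeterSystem w) : IsMStarWalk (m + 1) (heights w) := by
  obtain ⟨u, hu, rfl⟩ := (isFullyCommutative_iff_exists_tight w).1 hw.1
  rw [heights_wordProd]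
  refine ⟨fun i => ?_, crossings_zero _, crossings_wordPerm_eq_zero u (by simp)⟩
  exact isWalkStep_crossings hu.inversionsStraddle (wordPerm_involutive hw.2) i

lemma totalHeight_heights {w : (typeA m).Group}
    (hw : IsFullyCommutative (typeA m).toCoxeterSystem w) :
    totalHeight (m + 1) (heights w) = (typeA m).toCoxeterSystem.length w := by
  obtain ⟨u, hu, rfl⟩ := (isFullyCommutative_iff_exists_tight w).1 hw
  rw [hu.isReduced.eq, (tight_iff_length_eq u).1 hu, heights_wordProd, totalHeight,
    Fin.sum_univ_succ, Fin.sum_univ_castSucc]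
  simp [crossings_zero, crossings_wordPerm_eq_zero]

lemma heights_injOn : Set.InjOn (heights (m := m))
    {w | IsFCInvolution (typeA m).toCoxeterSystem w} := by
  intro w hw w' hw' h
  obtain ⟨u, hu, rfl⟩ := (isFullyCommutative_iff_exists_tight w).1 hw.1
  obtain ⟨v, hv, rfl⟩ := (isFullyCommutative_iff_exists_tight w').1 hw'.1
  rw [heights_wordProd, heights_wordProd] at h
  refine hu.wordProd_eq hv (hu.inversionsStraddle.eq_of_crossings_eq hv.inversionsStraddle
    (wordPerm_involutive hw.2) (wordPerm_involutive hw'.2) fun x => ?_)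
  by_cases hx : m < x
  · rw [crossings_wordPerm_eq_zero u hx, crossings_wordPerm_eq_zero v hx]
  · exact congrFun h ⟨x, by omega⟩

lemma exists_heights_eq {h : Fin (m + 1 + 1) → ℕ} (hh : IsMStarWalk (m + 1) h) :
    ∃ w, IsFCInvolution (typeA m).toCoxeterSystem w ∧ heights w = h := by
  obtain ⟨hstep, h0, hlast⟩ := hh
  obtain ⟨u, hu, hu2, hcr⟩ := exists_tight_of_walk (m := m)
    (fun x => if hx : x < m + 1 then h ⟨x, by omega⟩ else 0) (by simpa using h0)
    (fun x hx => dif_neg (by omega)) (fun x => by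
      by_cases hx : x < m + 1
      · have hs := hstep ⟨x, hx⟩
        by_cases hx' : x + 1 < m + 1
        · rw [dif_pos hx, dif_pos hx']
          exact hs
        · obtain rfl : x = m := by omega
          have : (Fin.succ ⟨x, hx⟩ : Fin (x + 1 + 1)) = Fin.last (x + 1) := rfl
          rw [this, hlast] at hs
          simpa using hs
      · have hx' : ¬ x + 1 < m + 1 := by omega
        simp only [hx, hx', dif_neg, not_false_eq_true]
        exact Or.inr (Or.inr ⟨rfl, rfl⟩))
  refine ⟨_, hu.isFCInvolution hu2, ?_⟩
  rw [heights_wordProd]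
  ext x
  rw [hcr]
  split_ifs with hx
  · rfl
  · rw [← hlast]
    congr 1
    ext
    simp only [Fin.val_last]
    omega

end Walks

lemma card_fcInvolutions_length (m L : ℕ) :
    Nat.card {w : (typeA m).Group //
        IsFCInvolution (typeA m).toCoxeterSystem w ∧
        (typeA m).toCoxeterSystem.length w = L} =
      Nat.card {h : Fin (m + 1 + 1) → ℕ //
        IsMStarWalk (m + 1) h ∧ totalHeight (m + 1) h = L} := by
  refine Nat.card_eq_of_bijective (fun w => ⟨heights w.1, isMStarWalk_heights w.2.1,
    (totalHeight_heights w.2.1.1).trans w.2.2⟩) ⟨fun w w' h => ?_, fun h => ?_⟩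
  · exact Subtype.ext (heights_injOn w.2.1 w'.2.1 (congrArg Subtype.val h))
  · obtain ⟨w, hw, hwh⟩ := exists_heights_eq h.2.1
    exact ⟨⟨w, hw, by rw [← totalHeight_heights hw.1, hwh, h.2.2]⟩, Subtype.ext hwh⟩

end FCInvolution

/-- For every `n ≥ 1` and every `L`, the number of fully commutative involutions of
Coxeter length `L` in the Coxeter group of type `A_{n-1}` equals the number of walks
in `M*_n` with total height `L`. -/
theorem card_fcInvolutions_length_typeA (n L : ℕ) (hn : 1 ≤ n) :
    Nat.card {w : (typeA (n - 1)).Group //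
        IsFCInvolution (typeA (n - 1)).toCoxeterSystem w ∧
        (typeA (n - 1)).toCoxeterSystem.length w = L} =
      Nat.card {h : Fin (n + 1) → ℕ // IsMStarWalk n h ∧ totalHeight n h = L} := by
  obtain ⟨m, rfl⟩ : ∃ m, n = m + 1 := ⟨n - 1, by omega⟩
  exact FCInvolution.card_fcInvolutions_length m L
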